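/- arXiv:1612.01301 — 4 statements merged into one kernel-verified Lean document; each statement's English description precedes it below -/
import Mathlib

section
/- For every p ≥ 1 and every α > 0 there exists a constant c₃ > 0 such that for all real numbers a ≥ 0 and b ≥ 0 one has |a - b|^{p-2}(a - b)(a^α - b^α) ≥ c₃ |a^{(p+α-1)/p} - b^{(p+α-1)/p}|^p. -/
/-- The function `t ↦ |t|^{p-2} t`, i.e. `sign(t)|t|^{p-1}`. -/
noncomputable def phiPow (p t : ℝ) : ℝ := Real.sign t * |t| ^ (p - 1)

theorem aux_up (g t : ℝ) (ht : 0 ≤ t) (ht1 : t ≤ 1) (hg : 0 < g) :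
    1 - t ^ g ≤ max 1 g * (1 - t) := by
  rcases le_total 1 g with h | h
  · rw [max_eq_right h]
    have := one_add_mul_self_le_rpow_one_add (s := t - 1) (by linarith) h
    rw [add_sub_cancel] at this
    linarith
  · rw [max_eq_left h]
    have := Real.rpow_le_rpow_of_exponent_ge' ht ht1 hg.le h
    rw [Real.rpow_one] at this
    linarith

theorem aux_low (g t : ℝ) (ht : 0 ≤ t) (ht1 : t ≤ 1) (hg : 0 < g) :
    min 1 g * (1 - t) ≤ 1 - t ^ g := by
  rcases le_total 1 g with h | h
  · rw [min_eq_left h]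
    have := Real.rpow_le_rpow_of_exponent_ge' ht ht1 zero_le_one h
    rw [Real.rpow_one] at this
    linarith
  · rw [min_eq_right h]
    have := rpow_one_add_le_one_add_mul_self (s := t - 1) (by linarith) hg.le h
    rw [add_sub_cancel] at this
    linarith

theorem aux_key (p α : ℝ) (hp : 1 ≤ p) (hα : 0 < α) (a b : ℝ) (hb : 0 ≤ b) (hab : b < a) :
    min 1 α / (max 1 ((p + α - 1) / p)) ^ p *
      |a ^ ((p + α - 1) / p) - b ^ ((p + α - 1) / p)| ^ p ≤
      (a - b) ^ (p - 1) * (a ^ α - b ^ α) := by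
  have ha : 0 < a := by linarith
  have hp0 : 0 < p := by linarith
  have hg : 0 < (p + α - 1) / p := div_pos (by linarith) hp0
  obtain ⟨g, hgd⟩ : ∃ g, g = (p + α - 1) / p := ⟨_, rfl⟩
  have hgp : g * p = p - 1 + α := by rw [hgd]; field_simp; ring
  rw [← hgd] at hg ⊢
  obtain ⟨t, rfl⟩ : ∃ t, b = a * t := ⟨b / a, by field_simp⟩
  have ht : 0 ≤ t := nonneg_of_mul_nonneg_right hb ha
  have ht1 : t < 1 := by
    by_contra h
    nlinarith
  have e : ∀ x : ℝ, a ^ x - (a * t) ^ x = a ^ x * (1 - t ^ x) := fun x => by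
    rw [Real.mul_rpow ha.le ht]; ring
  have h1 : 0 ≤ 1 - t ^ g := by
    have := Real.rpow_le_one ht ht1.le hg.le
    linarith
  have hs : 0 < 1 - t := by linarith
  have hag : 0 < a ^ g := Real.rpow_pos_of_pos ha g
  rw [e, e, abs_of_nonneg (mul_nonneg hag.le h1), Real.mul_rpow hag.le h1, ← Real.rpow_mul ha.le,
    hgp, Real.rpow_add ha, show a - a * t = a * (1 - t) by ring, Real.mul_rpow ha.le hs.le]
  have hM : 0 < max 1 g := lt_max_of_lt_left one_pos
  have hMp : 0 < (max 1 g) ^ p := Real.rpow_pos_of_pos hM p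
  have hm : 0 < min 1 α := lt_min one_pos hα
  have k1 : (1 - t ^ g) ^ p ≤ (max 1 g) ^ p * (1 - t) ^ p := by
    rw [← Real.mul_rpow hM.le hs.le]
    exact Real.rpow_le_rpow h1 (aux_up g t ht ht1.le hg) hp0.le
  have k2 := aux_low α t ht ht1.le hα
  have k3 : (1 - t) ^ p = (1 - t) ^ (p - 1) * (1 - t) := by
    rw [← Real.rpow_add_one hs.ne', sub_add_cancel]
  have k4 : min 1 α / (max 1 g) ^ p * (1 - t ^ g) ^ p ≤ (1 - t) ^ (p - 1) * (1 - t ^ α) := by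
    calc min 1 α / (max 1 g) ^ p * (1 - t ^ g) ^ p
        ≤ min 1 α / (max 1 g) ^ p * ((max 1 g) ^ p * (1 - t) ^ p) := by gcongr
      _ = (1 - t) ^ (p - 1) * (min 1 α * (1 - t)) := by rw [k3]; field_simp
      _ ≤ _ := by gcongr
  have hA : 0 ≤ a ^ (p - 1) * a ^ α := by positivity
  have := mul_le_mul_of_nonneg_left k4 hA
  linarith

/-- For `p ≥ 1` and `α > 0` there exists `c₃ > 0` such that for all `a, b ≥ 0`,
`|a-b|^{p-2}(a-b)(a^α - b^α) ≥ c₃ |a^{(p+α-1)/p} - b^{(p+α-1)/p}|^p`. -/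
theorem phiPow_mul_rpow_sub_ge (p α : ℝ) (hp : 1 ≤ p) (hα : 0 < α) :
    ∃ c₃ : ℝ, 0 < c₃ ∧
      ∀ a b : ℝ, 0 ≤ a → 0 ≤ b →
        phiPow p (a - b) * (a ^ α - b ^ α) ≥
          c₃ * |a ^ ((p + α - 1) / p) - b ^ ((p + α - 1) / p)| ^ p := by
  refine ⟨min 1 α / (max 1 ((p + α - 1) / p)) ^ p,
    div_pos (lt_min one_pos hα) (Real.rpow_pos_of_pos (lt_max_of_lt_left one_pos) p), ?_⟩
  intro a b ha hb
  unfold phiPow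
  rcases lt_trichotomy a b with h | rfl | h
  · have := aux_key p α hp hα b a ha h
    rw [Real.sign_of_neg (by linarith), abs_sub_comm a b, abs_of_pos (sub_pos.2 h),
      abs_sub_comm (a ^ ((p + α - 1) / p))]
    linarith
  · have hp0 : p ≠ 0 := by linarith
    simp [Real.zero_rpow hp0]
  · have := aux_key p α hp hα a b hb h
    rw [Real.sign_of_pos (by linarith), abs_of_pos (sub_pos.2 h)]
    linarith
end

section
/- For every p ≥ 1 and every α ≥ 1 there exists a constant c₄ > 0, independent of a and b, such that for all real numbers a ≥ 0 and b ≥ 0 one has (a + b)^{α-1} |a - b|^p ≤ c₄ |a^{(p+α-1)/p} - b^{(p+α-1)/p}|^p. -/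
theorem add_rpow_mul_abs_sub_le_aux (p α : ℝ) (hp : 1 ≤ p) (hα : 1 ≤ α) (a b : ℝ)
    (hb : 0 ≤ b) (hab : b ≤ a) :
    (a + b) ^ (α - 1) * |a - b| ^ p ≤
      2 ^ (α - 1) * |a ^ ((p + α - 1) / p) - b ^ ((p + α - 1) / p)| ^ p := by
  have ha : 0 ≤ a := hb.trans hab
  have hp0 : 0 < p := by linarith
  have hs : 0 ≤ (α - 1) / p := div_nonneg (by linarith) hp0.le
  have hr : (p + α - 1) / p = (α - 1) / p + 1 := by field_simp; ring
  have key : ∀ x : ℝ, 0 ≤ x → x ^ ((p + α - 1) / p) = x ^ ((α - 1) / p) * x := by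
    intro x hx
    rw [hr, Real.rpow_add_of_nonneg hx hs zero_le_one, Real.rpow_one]
  have hmono : b ^ ((α - 1) / p) ≤ a ^ ((α - 1) / p) := Real.rpow_le_rpow hb hab hs
  have h1 : a ^ ((α - 1) / p) * |a - b| ≤
      |a ^ ((p + α - 1) / p) - b ^ ((p + α - 1) / p)| := by
    rw [key a ha, key b hb, abs_of_nonneg (sub_nonneg.2 hab)]
    refine le_trans ?_ (le_abs_self _)
    nlinarith [mul_le_mul_of_nonneg_right hmono hb]
  have hA : 0 ≤ a ^ ((α - 1) / p) := Real.rpow_nonneg ha _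
  have h2 := Real.rpow_le_rpow (mul_nonneg hA (abs_nonneg (a - b))) h1 hp0.le
  rw [Real.mul_rpow hA (abs_nonneg _), ← Real.rpow_mul ha, div_mul_cancel₀ _ hp0.ne'] at h2
  have h3 : (a + b) ^ (α - 1) ≤ 2 ^ (α - 1) * a ^ (α - 1) := by
    rw [← Real.mul_rpow (by norm_num) ha]
    exact Real.rpow_le_rpow (by linarith) (by linarith) (by linarith)
  calc (a + b) ^ (α - 1) * |a - b| ^ p
      ≤ 2 ^ (α - 1) * a ^ (α - 1) * |a - b| ^ p :=
        mul_le_mul_of_nonneg_right h3 (by positivity)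
    _ = 2 ^ (α - 1) * (a ^ (α - 1) * |a - b| ^ p) := by ring
    _ ≤ _ := mul_le_mul_of_nonneg_left h2 (by positivity)

/-- For `p ≥ 1` and `α ≥ 1` there exists `c₄ > 0`, independent of `a` and `b`, such that
for all `a, b ≥ 0`, `(a+b)^{α-1} |a-b|^p ≤ c₄ |a^{(p+α-1)/p} - b^{(p+α-1)/p}|^p`. -/
theorem add_rpow_mul_abs_sub_le (p α : ℝ) (hp : 1 ≤ p) (hα : 1 ≤ α) :
    ∃ c₄ : ℝ, 0 < c₄ ∧
      ∀ a b : ℝ, 0 ≤ a → 0 ≤ b →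
        (a + b) ^ (α - 1) * |a - b| ^ p ≤
          c₄ * |a ^ ((p + α - 1) / p) - b ^ ((p + α - 1) / p)| ^ p := by
  refine ⟨2 ^ (α - 1), by positivity, fun a b ha hb => ?_⟩
  rcases le_total b a with h | h
  · exact add_rpow_mul_abs_sub_le_aux p α hp hα a b hb h
  · rw [add_comm a b, abs_sub_comm a b, abs_sub_comm (a ^ _) (b ^ _)]
    exact add_rpow_mul_abs_sub_le_aux p α hp hα b a ha h
end

section
/- Let p ≥ 1 and k > 0, let T_k(s) = max(-k, min(k, s)) and G_k(s) = s - T_k(s). Then for all real numbers a and b one has |a - b|^{p-2}(a - b)(G_k(a) - G_k(b)) ≥ |G_k(a) - G_k(b)|^p. -/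
/-- Truncation at level `k`: `T_k(s) = max(-k, min(k, s))`. -/
def truncAt (k s : ℝ) : ℝ := max (-k) (min k s)

/-- `G_k(s) = s - T_k(s)`. -/
def truncRem (k s : ℝ) : ℝ := s - truncAt k s

theorem truncRem_sub_bounds (k : ℝ) (hk : 0 < k) (a b : ℝ) (h : b ≤ a) :
    0 ≤ truncRem k a - truncRem k b ∧ truncRem k a - truncRem k b ≤ a - b := by
  unfold truncRem truncAt
  rcases max_cases (-k) (min k a) with h1 | h1 <;> rcases max_cases (-k) (min k b) with h2 | h2 <;>
  rcases min_cases k a with h3 | h3 <;> rcases min_cases k b with h4 | h4 <;>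
  constructor <;> linarith [h1.1, h1.2, h2.1, h2.2, h3.1, h3.2, h4.1, h4.2]

theorem rpow_le_mul_of_bounds (p g d : ℝ) (hp : 1 ≤ p) (hg : 0 < g) (hd : g ≤ d) :
    g ^ p ≤ d ^ (p - 1) * g := by
  have h1 : g ^ p = g ^ (p - 1) * g := by
    rw [← Real.rpow_add_one hg.ne' (p - 1)]
    congr 1
    ring
  rw [h1]
  exact mul_le_mul_of_nonneg_right
    (Real.rpow_le_rpow hg.le hd (by linarith)) hg.le

/-- For `p ≥ 1` and `k > 0`, for all reals `a, b`:
`|a-b|^{p-2}(a-b)(G_k(a) - G_k(b)) ≥ |G_k(a) - G_k(b)|^p`. -/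
theorem phiPow_mul_truncRem_sub_ge (p k : ℝ) (hp : 1 ≤ p) (hk : 0 < k) :
    ∀ a b : ℝ,
      phiPow p (a - b) * (truncRem k a - truncRem k b) ≥
        |truncRem k a - truncRem k b| ^ p := by
  intro a b
  by_cases hg : truncRem k a - truncRem k b = 0
  · rw [hg, abs_zero, mul_zero, Real.zero_rpow (by linarith)]
  rcases le_total b a with h | h
  · obtain ⟨h1, h2⟩ := truncRem_sub_bounds k hk a b h
    have h3 : 0 < truncRem k a - truncRem k b := lt_of_le_of_ne h1 (Ne.symm hg)
    have h4 : 0 < a - b := by linarith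
    rw [phiPow, Real.sign_of_pos h4, abs_of_pos h4, abs_of_pos h3, one_mul]
    exact rpow_le_mul_of_bounds p _ _ hp h3 h2
  · obtain ⟨h1, h2⟩ := truncRem_sub_bounds k hk b a h
    have h3 : truncRem k a - truncRem k b < 0 := lt_of_le_of_ne (by linarith) hg
    have h4 : a - b < 0 := by linarith
    rw [phiPow, Real.sign_of_neg h4, abs_of_neg h4, abs_of_neg h3]
    have h5 := rpow_le_mul_of_bounds p (-(truncRem k a - truncRem k b)) (-(a - b)) hp
      (by linarith) (by linarith)
    linarith
end

section
/- Let 1 < p < 2 and c > 0, and let F : [0, ∞) → ℝ be a differentiable nonnegative function satisfying F'(t) + c F(t)^{p/2} ≤ 0 for all t ≥ 0. Set T* = 2 F(0)^{(2-p)/2} / (c (2 - p)). Then F(t) = 0 for every t ≥ T*. -/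
/-- Finite-time extinction for the ODE inequality `F' + c F^{p/2} ≤ 0` with `1 < p < 2`:
`F(t) = 0` for all `t ≥ T* = 2 F(0)^{(2-p)/2} / (c(2-p))`. -/
theorem extinction_of_ode_inequality (p c : ℝ) (hp1 : 1 < p) (hp2 : p < 2) (hc : 0 < c)
    (F : ℝ → ℝ) (hF : Differentiable ℝ F) (hF0 : ∀ t, 0 ≤ t → 0 ≤ F t)
    (hineq : ∀ t, 0 ≤ t → deriv F t + c * F t ^ (p / 2) ≤ 0) :
    ∀ t, 2 * F 0 ^ ((2 - p) / 2) / (c * (2 - p)) ≤ t → F t = 0 := by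
  intro t ht
  have hcp : 0 < c * (2 - p) := mul_pos hc (by linarith)
  have ht0 : 0 ≤ t := by
    refine le_trans ?_ ht
    have := Real.rpow_nonneg (hF0 0 le_rfl) ((2 - p) / 2)
    positivity
  by_contra hne
  have hpos : 0 < F t := lt_of_le_of_ne (hF0 t ht0) (Ne.symm hne)
  have hanti : AntitoneOn F (Set.Ici 0) := by
    refine antitoneOn_of_deriv_nonpos (convex_Ici 0) hF.continuous.continuousOn
      hF.differentiableOn ?_
    intro x hx
    rw [interior_Ici] at hx
    have hx0 : (0:ℝ) ≤ x := le_of_lt hx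
    have h1 := hineq x hx0
    have h2 := mul_nonneg hc.le (Real.rpow_nonneg (hF0 x hx0) (p / 2))
    linarith
  have hpos' : ∀ s ∈ Set.Icc 0 t, 0 < F s := fun s hs =>
    lt_of_lt_of_le hpos (hanti hs.1 ht0 hs.2)
  have hder : ∀ s ∈ Set.Icc 0 t, HasDerivAt (fun s => F s ^ ((2 - p) / 2) + c * ((2 - p) / 2) * s)
      (deriv F s * ((2 - p) / 2) * F s ^ ((2 - p) / 2 - 1) + c * ((2 - p) / 2) * 1) s := by
    intro s hs
    exact ((hF s).hasDerivAt.rpow_const (Or.inl (hpos' s hs).ne')).add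
      ((hasDerivAt_id s).const_mul _)
  have hG : AntitoneOn (fun s => F s ^ ((2 - p) / 2) + c * ((2 - p) / 2) * s) (Set.Icc 0 t) := by
    refine antitoneOn_of_deriv_nonpos (convex_Icc 0 t)
      (fun s hs => (hder s hs).continuousAt.continuousWithinAt)
      (fun s hs => (hder s (interior_subset hs)).differentiableAt.differentiableWithinAt) ?_
    intro s hs
    have hs' := interior_subset hs
    rw [(hder s hs').deriv]
    have hm : F s ^ (p / 2) * F s ^ ((2 - p) / 2 - 1) = 1 := by
      rw [← Real.rpow_add (hpos' s hs')]
      have : p / 2 + ((2 - p) / 2 - 1) = 0 := by ring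
      rw [this, Real.rpow_zero]
    have hk : 0 ≤ (2 - p) / 2 * F s ^ ((2 - p) / 2 - 1) :=
      mul_nonneg (by linarith) (Real.rpow_nonneg (hpos' s hs').le _)
    have h3 := mul_nonpos_of_nonpos_of_nonneg (hineq s hs'.1) hk
    have h4 : (deriv F s + c * F s ^ (p / 2)) * ((2 - p) / 2 * F s ^ ((2 - p) / 2 - 1))
        = deriv F s * ((2 - p) / 2) * F s ^ ((2 - p) / 2 - 1)
          + c * ((2 - p) / 2) * (F s ^ (p / 2) * F s ^ ((2 - p) / 2 - 1)) := by ring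
    rw [h4, hm] at h3
    exact h3
  have h5 := hG (Set.left_mem_Icc.2 ht0) (Set.right_mem_Icc.2 ht0) ht0
  simp only at h5
  have h6 := Real.rpow_pos_of_pos hpos ((2 - p) / 2)
  rw [div_le_iff₀ hcp] at ht
  nlinarith
end
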